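/- arXiv:2005.12505 — 2 statements merged into one kernel-verified Lean document; each statement's English description precedes it below -/
import Mathlib

section
/- Consider the consensus-voting group process on the closed unit disk 𝔹 (members and candidates drawn uniformly from 𝔹). Then there exists a constant c > 0 such that for every T ≥ 1, the expected group size after T rounds satisfies E[|G^T|] ≥ c·T^{1/8}. -/
open MeasureTheory Metric Set
open scoped RealInnerProductSpace ENNReal

noncomputable section

/-- Points of the plane (with the Euclidean norm). -/
abbrev Pt : Type := EuclideanSpace ℝ (Fin 2)

/-- The Voronoi cell of `w₁` (against competitor `w₂`) inside `K`. -/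
def vcell (K : Set Pt) (w₁ w₂ : Pt) : Set Pt := {v ∈ K | dist v w₁ ≤ dist v w₂}

/-- The acceptance event `E_K(H, A)`: the set of candidate pairs `(w₁, w₂) ∈ K × K` such
that some candidate `wᵢ` lies in `H` and `A` is contained in its Voronoi cell, i.e. a
candidate inside `H` is accepted when the convex hull of the group is `A`. -/
def accEvent (K H A : Set Pt) : Set (Pt × Pt) :=
  {p | p.1 ∈ K ∧ p.2 ∈ K ∧
    ((p.1 ∈ H ∧ A ⊆ vcell K p.1 p.2) ∨ (p.2 ∈ H ∧ A ⊆ vcell K p.2 p.1))}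

/-- Every group member weakly prefers candidate `w₁` to candidate `w₂`. -/
def Accepts (G : Set Pt) (w₁ w₂ : Pt) : Prop := ∀ v ∈ G, dist v w₁ ≤ dist v w₂

open Classical in
/-- One round of the consensus-voting process: given the current group `G` and a pair of
candidates `c = (w₁, w₂)`, the unanimously preferred candidate (if any) joins the group. -/
def step (G : Set Pt) (c : Pt × Pt) : Set Pt :=
  if Accepts G c.1 c.2 then insert c.1 G
  else if Accepts G c.2 c.1 then insert c.2 G
  else G

/-- The group after `t` rounds, from initial members `init` and candidate pairs `c`. -/
def grp {k : ℕ} (init : Fin k → Pt) (c : ℕ → Pt × Pt) : ℕ → Set Pt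
  | 0 => Set.range init
  | t + 1 => step (grp init c t) (c t)

/-- Extend a `Fin T`-indexed sequence of candidate pairs to an `ℕ`-indexed one. -/
def extSeq {T : ℕ} (c : Fin T → Pt × Pt) : ℕ → Pt × Pt :=
  fun n => if h : n < T then c ⟨n, h⟩ else 0

/-- The law of the randomness driving the first `T` rounds of the process: `k` i.i.d.
initial members with law `μ`, and `T` i.i.d. candidate pairs, each pair being two i.i.d.
points with law `μ`. -/
def procMeasure (μ : Measure Pt) (k T : ℕ) :
    Measure ((Fin k → Pt) × (Fin T → Pt × Pt)) :=
  (Measure.pi fun _ => μ).prod (Measure.pi fun _ => μ.prod μ)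


/-- The closed unit disk in the plane. -/
def unitDisk : Set Pt := Metric.closedBall 0 1

/-- The uniform probability measure on the closed unit disk. -/
def unifDisk : Measure Pt := (volume unitDisk)⁻¹ • volume.restrict unitDisk


/-- The reference event (cap at the point `(1,0)`). -/
def refEvent (r : ℝ) : Set (Pt × Pt) :=
  {p | (1 - 5 * r ^ 2 / 8 ≤ p.1 0 ∧ p.1 0 ≤ 1 - r ^ 2 / 2 ∧
        p.2 1 ≤ p.1 1 ∧ p.1 1 ≤ p.2 1 + r ^ 3 / 64) ∧
       (1 - 3 * r ^ 2 / 8 ≤ p.2 0 ∧ p.2 0 ≤ 1 - r ^ 2 / 4 ∧ 0 ≤ p.2 1 ∧ p.2 1 ≤ r / 4)}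

lemma norm_le_one_iff (x : Pt) : x ∈ unitDisk ↔ x 0 ^ 2 + x 1 ^ 2 ≤ 1 := by
  rw [unitDisk, mem_closedBall_zero_iff, EuclideanSpace.norm_eq, Real.sqrt_le_one]
  simp [Fin.sum_univ_two]

lemma refEvent_accept {r : ℝ} (hr : 0 < r) (hr1 : r ≤ 1) {p : Pt × Pt} (hp : p ∈ refEvent r)
    {v : Pt} (hv : v ∈ unitDisk) (hv0 : v 0 ≤ 1 - r ^ 2) : dist v p.1 ≤ dist v p.2 := by
  obtain ⟨⟨h1, h2, h3, h4⟩, h5, h6, h7, h8⟩ := hp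
  rw [norm_le_one_iff] at hv
  rw [EuclideanSpace.dist_eq, EuclideanSpace.dist_eq]
  apply Real.sqrt_le_sqrt
  simp only [Fin.sum_univ_two, Real.dist_eq, sq_abs]
  generalize v 0 = x at *
  generalize v 1 = y at *
  generalize p.1 0 = x1 at *
  generalize p.1 1 = y1 at *
  generalize p.2 0 = x2 at *
  generalize p.2 1 = y2 at *
  obtain ⟨q, hq0, hq⟩ : ∃ q : ℝ, 0 ≤ q ∧ q ^ 2 = 1 - x :=
    ⟨Real.sqrt (1 - x), Real.sqrt_nonneg _, Real.sq_sqrt (by nlinarith)⟩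
  have hrq : r ≤ q := by
    apply le_of_sq_le_sq _ hq0
    linarith
  have hy : -y ≤ 2 * q := by
    have : y ^ 2 ≤ (2 * q) ^ 2 := by nlinarith
    have := abs_le_of_sq_le_sq this (by linarith)
    linarith [neg_abs_le y]
  have hr3 : r ^ 3 ≤ r := by
    have : r ^ 2 ≤ 1 := by nlinarith
    nlinarith
  have hA : ((y1 + y2) / 2 - y) * (y1 - y2) ≤ (3 * q) * (r ^ 3 / 64) := by
    by_cases hc : 0 ≤ (y1 + y2) / 2 - y
    · apply mul_le_mul _ _ (by linarith) (by linarith)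
      · linarith
      · linarith
    · have h1 : ((y1 + y2) / 2 - y) * (y1 - y2) ≤ 0 :=
        mul_nonpos_of_nonpos_of_nonneg (by linarith) (by linarith)
      have : 0 ≤ (3 * q) * (r ^ 3 / 64) := by positivity
      linarith
  have hB : (3 * q) * (r ^ 3 / 64) ≤ 3 * q ^ 2 * r ^ 2 / 64 := by
    have : r * (q * r ^ 2) ≤ q * (q * r ^ 2) := mul_le_mul_of_nonneg_right hrq (by positivity)
    nlinarith
  have hC : (q ^ 2 / 2) * (r ^ 2 / 8) ≤ ((x1 + x2) / 2 - x) * (x2 - x1) := by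
    have : r ^ 2 ≤ q ^ 2 := by linarith
    apply mul_le_mul _ _ (by positivity) _
    · linarith
    · linarith
    · linarith [sq_nonneg q, sq_nonneg r]
  have hD : 0 ≤ q ^ 2 * r ^ 2 := by positivity
  nlinarith

lemma refEvent_cap {r : ℝ} (hr : 0 < r) {p : Pt × Pt} (hp : p ∈ refEvent r) :
    1 - r ^ 2 < p.1 0 := by
  obtain ⟨⟨h1, h2, h3, h4⟩, h5, h6, h7, h8⟩ := hp
  have : 0 < r ^ 2 := by positivity
  linarith

lemma measurableSet_refEvent (r : ℝ) : MeasurableSet (refEvent r) := by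
  apply IsClosed.measurableSet
  unfold refEvent
  simp only [setOf_and]
  have c1 : ∀ i, Continuous fun p : Pt × Pt => p.1 i := fun i => by fun_prop
  have c2 : ∀ i, Continuous fun p : Pt × Pt => p.2 i := fun i => by fun_prop
  repeat' apply IsClosed.inter
  all_goals apply isClosed_le <;> fun_prop

/-- Coordinate rectangle. -/
def rect (a b c d : ℝ) : Set Pt := {x | a ≤ x 0 ∧ x 0 ≤ b ∧ c ≤ x 1 ∧ x 1 ≤ d}

lemma volume_rect (a b c d : ℝ) :
    volume (rect a b c d) = ENNReal.ofReal (b - a) * ENNReal.ofReal (d - c) := by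
  have h : rect a b c d = (WithLp.ofLp : Pt → (Fin 2 → ℝ)) ⁻¹' (Icc ![a, c] ![b, d]) := by
    ext x
    simp [rect, Pi.le_def, Fin.forall_fin_two]
    tauto
  rw [h, (PiLp.volume_preserving_ofLp (Fin 2)).measure_preimage
    measurableSet_Icc.nullMeasurableSet, Real.volume_Icc_pi]
  simp [Fin.prod_univ_two]

lemma measurableSet_rect (a b c d : ℝ) : MeasurableSet (rect a b c d) := by
  apply IsClosed.measurableSet
  unfold rect
  simp only [setOf_and]
  repeat' apply IsClosed.inter
  all_goals apply isClosed_le <;> fun_prop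

lemma vol_pos : volume unitDisk ≠ 0 := by
  exact (measure_closedBall_pos volume (0 : Pt) one_pos).ne'

lemma vol_fin : volume unitDisk ≠ ⊤ := measure_closedBall_lt_top.ne

instance : IsProbabilityMeasure unifDisk := by
  constructor
  simp only [unifDisk, Measure.smul_apply, Measure.restrict_apply_univ, smul_eq_mul]
  exact ENNReal.inv_mul_cancel vol_pos vol_fin

lemma unif_rect {a b c d : ℝ} (h : rect a b c d ⊆ unitDisk) :
    unifDisk (rect a b c d) =
      (volume unitDisk)⁻¹ * (ENNReal.ofReal (b - a) * ENNReal.ofReal (d - c)) := by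
  rw [unifDisk, Measure.smul_apply, Measure.restrict_apply (measurableSet_rect _ _ _ _),
    inter_eq_self_of_subset_left h, volume_rect, smul_eq_mul]

lemma rect_sub {r a b c d : ℝ} (hr : 0 < r) (hr1 : r ≤ 1) (ha : 0 ≤ a) (hb : b ≤ 1 - r ^ 2 / 4)
    (hc : 0 ≤ c) (hd : d ≤ r / 2) : rect a b c d ⊆ unitDisk := by
  rintro x ⟨h1, h2, h3, h4⟩
  rw [norm_le_one_iff]
  have : x 1 ^ 2 ≤ (r / 2) ^ 2 := pow_le_pow_left₀ (by linarith) (by linarith) 2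
  have : x 0 ^ 2 ≤ x 0 := by nlinarith
  nlinarith

lemma prob_refEvent {r : ℝ} (hr : 0 < r) (hr1 : r ≤ 1) :
    (volume unitDisk)⁻¹ * (volume unitDisk)⁻¹ * ENNReal.ofReal (r ^ 8 / 16384) ≤
      (unifDisk.prod unifDisk) (refEvent r) := by
  have hr2 : r ^ 2 ≤ 1 := by nlinarith
  have hr3 : r ^ 3 ≤ r := by nlinarith
  rw [Measure.prod_apply_symm (measurableSet_refEvent r)]
  set B := rect (1 - 3 * r ^ 2 / 8) (1 - r ^ 2 / 4) 0 (r / 4) with hB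
  have key : ∀ y ∈ B, (volume unitDisk)⁻¹ * (ENNReal.ofReal (r ^ 2 / 8) *
      ENNReal.ofReal (r ^ 3 / 64)) ≤ unifDisk ((fun x => (x, y)) ⁻¹' refEvent r) := by
    rintro y ⟨h1, h2, h3, h4⟩
    have e : (fun x => (x, y)) ⁻¹' refEvent r =
        rect (1 - 5 * r ^ 2 / 8) (1 - r ^ 2 / 2) (y 1) (y 1 + r ^ 3 / 64) := by
      ext x
      simp only [refEvent, rect, mem_preimage, mem_setOf_eq]
      tauto
    rw [e, unif_rect]
    · apply le_of_eq
      congr 3 <;> ring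
    · apply rect_sub hr hr1 <;> nlinarith
  calc _ = (volume unitDisk)⁻¹ * (ENNReal.ofReal (r ^ 2 / 8) * ENNReal.ofReal (r ^ 3 / 64)) *
        unifDisk B := by
        rw [hB, unif_rect (rect_sub hr hr1 (by nlinarith) le_rfl le_rfl (by linarith))]
        rw [show r ^ 8 / 16384 = (r ^ 2 / 8) * (r ^ 3 / 64) *
          ((1 - r ^ 2 / 4 - (1 - 3 * r ^ 2 / 8)) * (r / 4 - 0)) by ring,
          ENNReal.ofReal_mul (by positivity), ENNReal.ofReal_mul (by positivity),
          ENNReal.ofReal_mul (by nlinarith)]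
        ring
    _ = ∫⁻ y in B, (volume unitDisk)⁻¹ * (ENNReal.ofReal (r ^ 2 / 8) *
          ENNReal.ofReal (r ^ 3 / 64)) ∂unifDisk := by
        rw [setLIntegral_const]
    _ ≤ ∫⁻ y in B, unifDisk ((fun x => (x, y)) ⁻¹' refEvent r) ∂unifDisk :=
        setLIntegral_mono' (measurableSet_rect _ _ _ _) key
    _ ≤ _ := setLIntegral_le_lintegral _ _

/-- Rotation of the plane. -/
def rot (θ : ℝ) : Pt ≃ₗᵢ[ℝ] Pt :=
  (Complex.orthonormalBasisOneI.repr.symm.trans (rotation (Circle.exp θ))).trans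
    Complex.orthonormalBasisOneI.repr

/-- center of the cap -/
def e0 : Pt := !₂[1, 0]

lemma rot_e0 (θ : ℝ) : (rot θ e0) 1 = Real.sin θ := by
  have h : Complex.orthonormalBasisOneI.repr.symm e0 = 1 := by
    rw [LinearIsometryEquiv.symm_apply_eq]
    ext i
    fin_cases i <;> simp [e0]
  simp only [rot, LinearIsometryEquiv.trans_apply, h]
  simp [Complex.exp_im]

lemma rot_mp (θ : ℝ) : MeasurePreserving (rot θ) unifDisk unifDisk := by
  have h1 : MeasurePreserving (rot θ) volume volume := (rot θ).measurePreserving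
  have h2 : (rot θ) ⁻¹' unitDisk = unitDisk := by
    ext x; simp [unitDisk]
  have h3 := h1.restrict_preimage (s := unitDisk) measurableSet_closedBall
  rw [h2] at h3
  exact h3.smul_measure _

/-- rotated event -/
def rotEvent (θ r : ℝ) : Set (Pt × Pt) := (Prod.map (rot θ).symm (rot θ).symm) ⁻¹' refEvent r

/-- rotated cap -/
def cap (θ r : ℝ) : Set Pt := {x | 1 - r ^ 2 < ((rot θ).symm x) 0}

lemma rot_symm_mp (θ : ℝ) : MeasurePreserving (rot θ).symm unifDisk unifDisk := 
  (rot_mp θ).symm (rot θ).toHomeomorph.toMeasurableEquiv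

lemma measurableSet_rotEvent (θ r : ℝ) : MeasurableSet (rotEvent θ r) :=
  ((rot_symm_mp θ).prod (rot_symm_mp θ)).measurable (measurableSet_refEvent r)

lemma prob_rotEvent (θ r : ℝ) : (unifDisk.prod unifDisk) (rotEvent θ r) =
    (unifDisk.prod unifDisk) (refEvent r) :=
  ((rot_symm_mp θ).prod (rot_symm_mp θ)).measure_preimage
    (measurableSet_refEvent r).nullMeasurableSet

lemma cap_near {θ r : ℝ} (hr : 0 < r) {x : Pt} (hx : x ∈ cap θ r) (hd : x ∈ unitDisk) :
    |x 1 - Real.sin θ| < 3 / 2 * r := by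
  have h1 : (rot θ).symm x ∈ unitDisk := by simpa [unitDisk] using hd
  rw [norm_le_one_iff] at h1
  have hx' : 1 - r ^ 2 < ((rot θ).symm x) 0 := hx
  have h2 : dist x (rot θ e0) < 3 / 2 * r := by
    rw [← (rot θ).symm.dist_map, LinearIsometryEquiv.symm_apply_apply, EuclideanSpace.dist_eq,
      Real.sqrt_lt' (by positivity)]
    simp only [Fin.sum_univ_two, Real.dist_eq, sq_abs, e0]
    simp
    nlinarith [sq_pos_of_pos hr]
  rw [← rot_e0]
  refine lt_of_le_of_lt ?_ h2
  rw [dist_eq_norm]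
  have := PiLp.norm_apply_le (x - rot θ e0) 1
  simpa using this

lemma step_mono (G : Set Pt) (c : Pt × Pt) : G ⊆ step G c := by
  unfold step
  split_ifs <;> simp

lemma step_finite {G : Set Pt} (hG : G.Finite) (c : Pt × Pt) : (step G c).Finite := by
  unfold step
  split_ifs <;> simp [hG]

lemma step_sub {G : Set Pt} (hG : G ⊆ unitDisk) {c : Pt × Pt} (h1 : c.1 ∈ unitDisk)
    (h2 : c.2 ∈ unitDisk) : step G c ⊆ unitDisk := by
  unfold step
  split_ifs <;> simp [insert_subset_iff, *]

lemma step_cap {G : Set Pt} (hG : G ⊆ unitDisk) {c : Pt × Pt} {θ r : ℝ} (hr : 0 < r)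
    (hr1 : r ≤ 1) (hc : c ∈ rotEvent θ r) : (step G c ∩ cap θ r).Nonempty := by
  by_cases h : (G ∩ cap θ r).Nonempty
  · exact h.mono (inter_subset_inter_left _ (step_mono G c))
  · have hacc : Accepts G c.1 c.2 := by
      intro v hv
      rw [← (rot θ).symm.dist_map v, ← (rot θ).symm.dist_map v]
      refine refEvent_accept hr hr1 (p := Prod.map (rot θ).symm (rot θ).symm c) hc ?_ ?_
      · simpa [unitDisk] using hG hv
      · by_contra hlt
        exact h ⟨v, hv, not_le.1 hlt⟩
    refine ⟨c.1, ?_, refEvent_cap hr (p := Prod.map (rot θ).symm (rot θ).symm c) hc⟩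
    simp [step, hacc]

section proc
variable {k : ℕ} (init : Fin k → Pt) (c : ℕ → Pt × Pt)

lemma grp_finite (t : ℕ) : (grp init c t).Finite := by
  induction t with
  | zero => exact finite_range init
  | succ t ih => exact step_finite ih _

lemma grp_mono {s t : ℕ} (h : s ≤ t) : grp init c s ⊆ grp init c t :=
  monotone_nat_of_le_succ (f := grp init c) (fun t => step_mono _ _) h

lemma grp_sub (hi : ∀ i, init i ∈ unitDisk) (T : ℕ)
    (hc : ∀ t < T, (c t).1 ∈ unitDisk ∧ (c t).2 ∈ unitDisk) :
    grp init c T ⊆ unitDisk := by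
  induction T with
  | zero => rintro _ ⟨i, rfl⟩; exact hi i
  | succ t ih =>
    exact step_sub (ih fun s hs => hc s (by omega)) (hc t (by omega)).1 (hc t (by omega)).2

end proc

lemma ncard_ge {M T k : ℕ} {r : ℝ} (hr : 0 < r) (hr1 : r ≤ 1) (θ : Fin M → ℝ)
    (hθ : ∀ i j, i ≠ j → 3 * r ≤ |Real.sin (θ i) - Real.sin (θ j)|)
    (init : Fin k → Pt) (c : Fin T → Pt × Pt) (hi : ∀ i, init i ∈ unitDisk)
    (hc : ∀ t, (c t).1 ∈ unitDisk ∧ (c t).2 ∈ unitDisk) :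
    ∑ j : Fin M, ({ω : Fin T → Pt × Pt | ∃ t, ω t ∈ rotEvent (θ j) r}.indicator
      (fun _ => (1 : ℝ≥0∞)) c) ≤ ((grp init (extSeq c) T).ncard : ℝ≥0∞) := by
  classical
  have hext : ∀ t (h : t < T), extSeq c t = c ⟨t, h⟩ := fun t h => by simp [extSeq, h]
  have hc' : ∀ t < T, (extSeq c t).1 ∈ unitDisk ∧ (extSeq c t).2 ∈ unitDisk := by
    intro t h; rw [hext t h]; exact hc _
  set J : Finset (Fin M) := Finset.univ.filter fun j => ∃ t, c t ∈ rotEvent (θ j) r with hJ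
  have hsum : ∑ j : Fin M, ({ω : Fin T → Pt × Pt | ∃ t, ω t ∈ rotEvent (θ j) r}.indicator
      (fun _ => (1 : ℝ≥0∞)) c) = (J.card : ℝ≥0∞) := by
    simp [indicator_apply, hJ]
  rw [hsum]
  have hex : ∀ j ∈ J, (grp init (extSeq c) T ∩ cap (θ j) r).Nonempty := by
    intro j hj
    obtain ⟨t, ht⟩ := (Finset.mem_filter.1 hj).2
    have hs : grp init (extSeq c) t ⊆ unitDisk :=
      grp_sub _ _ hi t fun s hs => hc' s (hs.trans t.2)
    have := step_cap (G := grp init (extSeq c) t) hs hr hr1 ht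
    refine this.mono (inter_subset_inter_left _ ?_)
    have h2 : step (grp init (extSeq c) t) (c t) = grp init (extSeq c) (t + 1) := by
      rw [grp, hext t t.2]
    rw [h2]
    exact grp_mono _ _ t.2
  choose! f hf using hex
  have hG := grp_finite init (extSeq c) T
  have hGs := grp_sub init (extSeq c) hi T hc'
  have : J.card ≤ (grp init (extSeq c) T).ncard := by
    rw [← Set.ncard_coe_finset J]
    refine Set.ncard_le_ncard_of_injOn f (fun j hj => (hf j hj).1) ?_ hG
    intro i hi' j hj hij
    by_contra hne
    have h1 := cap_near hr (hf i hi').2 (hGs (hf i hi').1)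
    have h2 := cap_near hr (hf j hj).2 (hGs (hf j hj).1)
    rw [hij] at h1
    have h3 := hθ i j hne
    have h4 : |Real.sin (θ i) - Real.sin (θ j)| < 3 * r := by
      rw [abs_lt] at *
      constructor <;> linarith [h1.1, h1.2, h2.1, h2.2]
    linarith
  exact_mod_cast this

lemma ae_mem : ∀ᵐ x ∂unifDisk, x ∈ unitDisk := by
  unfold unifDisk
  exact Measure.ae_smul_measure (ae_restrict_mem measurableSet_closedBall) _

lemma expected_ge {M T k : ℕ} {r : ℝ} (hr : 0 < r) (hr1 : r ≤ 1) (θ : Fin M → ℝ)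
    (hθ : ∀ i j, i ≠ j → 3 * r ≤ |Real.sin (θ i) - Real.sin (θ j)|) :
    (M : ℝ≥0∞) * (1 - (1 - (unifDisk.prod unifDisk) (refEvent r)) ^ T) ≤
      ∫⁻ ω, ((grp ω.1 (extSeq ω.2) T).ncard : ℝ≥0∞) ∂(procMeasure unifDisk k T) := by
  set ν := (Measure.pi fun _ : Fin T => unifDisk.prod unifDisk) with hν
  have hA : ∀ j, MeasurableSet {ω : Fin T → Pt × Pt | ∃ t, ω t ∈ rotEvent (θ j) r} := by
    intro j
    rw [setOf_exists]
    exact MeasurableSet.iUnion fun t => measurable_pi_apply t (measurableSet_rotEvent _ _)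
  have hP : ∀ j, ν {ω : Fin T → Pt × Pt | ∃ t, ω t ∈ rotEvent (θ j) r} =
      1 - (1 - (unifDisk.prod unifDisk) (refEvent r)) ^ T := by
    intro j
    have hcompl : {ω : Fin T → Pt × Pt | ∃ t, ω t ∈ rotEvent (θ j) r} =
        (univ.pi fun _ : Fin T => (rotEvent (θ j) r)ᶜ)ᶜ := by
      ext ω; simp
    rw [hcompl, prob_compl_eq_one_sub, hν, Measure.pi_pi]
    · simp [prob_compl_eq_one_sub (measurableSet_rotEvent (θ j) r), prob_rotEvent]
    · exact MeasurableSet.univ_pi fun _ => (measurableSet_rotEvent _ _).compl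
  have hae1 : ∀ᵐ ω ∂(procMeasure unifDisk k T), ∀ i, ω.1 i ∈ unitDisk := by
    rw [ae_all_iff]
    intro i
    exact ((Measure.quasiMeasurePreserving_eval (fun _ : Fin k => unifDisk) i).comp
      Measure.quasiMeasurePreserving_fst).ae ae_mem
  have hae2 : ∀ᵐ ω ∂(procMeasure unifDisk k T), ∀ t,
      (ω.2 t).1 ∈ unitDisk ∧ (ω.2 t).2 ∈ unitDisk := by
    rw [ae_all_iff]
    intro t
    have hq := (Measure.quasiMeasurePreserving_eval
      (fun _ : Fin T => unifDisk.prod unifDisk) t).comp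
      (Measure.quasiMeasurePreserving_snd (μ := Measure.pi fun _ : Fin k => unifDisk))
    exact ((Measure.quasiMeasurePreserving_fst.comp hq).ae ae_mem).and
      ((Measure.quasiMeasurePreserving_snd.comp hq).ae ae_mem)
  calc _ = ∑ j : Fin M, ν {ω : Fin T → Pt × Pt | ∃ t, ω t ∈ rotEvent (θ j) r} := by
        simp [hP]
    _ = ∫⁻ c, ∑ j : Fin M, ({ω : Fin T → Pt × Pt | ∃ t, ω t ∈ rotEvent (θ j) r}.indicator
          (fun _ => (1 : ℝ≥0∞)) c) ∂ν := by
        rw [lintegral_finsetSum _ fun j _ => measurable_const.indicator (hA j)]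
        simp [lintegral_indicator (hA _)]
    _ = ∫⁻ ω, ∑ j : Fin M, ({ω : Fin T → Pt × Pt | ∃ t, ω t ∈ rotEvent (θ j) r}.indicator
          (fun _ => (1 : ℝ≥0∞)) ω.2) ∂(procMeasure unifDisk k T) := by
        refine ((measurePreserving_snd (μ := Measure.pi fun _ : Fin k => unifDisk)
          (ν := ν)).lintegral_comp ?_).symm
        exact Finset.measurable_fun_sum _ fun j _ => measurable_const.indicator (hA j)
    _ ≤ _ := by
        apply lintegral_mono_ae
        filter_upwards [hae1, hae2] with ω h1 h2
        exact ncard_ge hr hr1 θ hθ ω.1 ω.2 h1 h2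

/-- For the consensus-voting group process on the closed unit disk
(with `k ≥ 1` uniform initial members and two i.i.d. uniform candidates per round), there
is a constant `c > 0` such that for every `T ≥ 1` the expected group size after `T` rounds
satisfies `E[|G^T|] ≥ c · T^{1/8}`. -/
theorem expected_group_size_disk_lower (k : ℕ) (hk : 1 ≤ k) :
    ∃ c : ℝ, 0 < c ∧ ∀ T : ℕ, 1 ≤ T →
      ENNReal.ofReal (c * (T : ℝ) ^ ((1 : ℝ) / 8)) ≤
        ∫⁻ ω, ((grp ω.1 (extSeq ω.2) T).ncard : ℝ≥0∞) ∂(procMeasure unifDisk k T) := by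
  obtain ⟨V, hV, hVv⟩ : ∃ V : ℝ, 0 < V ∧
      (volume unitDisk)⁻¹ * (volume unitDisk)⁻¹ = ENNReal.ofReal V := by
    have hne : (volume unitDisk)⁻¹ * (volume unitDisk)⁻¹ ≠ ⊤ :=
      ENNReal.mul_ne_top (ENNReal.inv_ne_top.2 vol_pos) (ENNReal.inv_ne_top.2 vol_pos)
    have h0 : (volume unitDisk)⁻¹ * (volume unitDisk)⁻¹ ≠ 0 :=
      mul_ne_zero (ENNReal.inv_ne_zero.2 vol_fin) (ENNReal.inv_ne_zero.2 vol_fin)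
    exact ⟨_, ENNReal.toReal_pos h0 hne, (ENNReal.ofReal_toReal hne).symm⟩
  set C : ℝ := V / (16384 * 6 ^ 8) with hC
  have hCpos : 0 < C := by positivity
  refine ⟨1 - Real.exp (-C), by simpa using hCpos, fun T hT => ?_⟩
  have hT' : (1 : ℝ) ≤ T := by exact_mod_cast hT
  set a : ℝ := (T : ℝ) ^ ((1 : ℝ) / 8) with ha
  have ha1 : 1 ≤ a := Real.one_le_rpow hT' (by norm_num)
  have ha8 : a ^ 8 = T := by
    rw [ha, ← Real.rpow_natCast, ← Real.rpow_mul (by linarith)]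
    norm_num
  set M : ℕ := ⌈a⌉₊ with hM
  have hMa : a ≤ M := Nat.le_ceil a
  have hMa2 : (M : ℝ) ≤ 2 * a := by
    have := Nat.ceil_lt_add_one (a := a) (by linarith)
    linarith
  have hM0 : (0 : ℝ) < M := by linarith
  set r : ℝ := 1 / (3 * M) with hrdef
  have hr : 0 < r := by positivity
  have hr1 : r ≤ 1 := by
    rw [hrdef, div_le_one (by positivity)]
    linarith
  have h3r : 3 * r = 1 / M := by
    rw [hrdef]; field_simp
  set θ : Fin M → ℝ := fun j => Real.arcsin ((j : ℕ) / (M : ℝ)) with hθd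
  have hsin : ∀ j, Real.sin (θ j) = (j : ℕ) / (M : ℝ) := by
    intro j
    have h0 : (0 : ℝ) ≤ (j : ℕ) / (M : ℝ) := by positivity
    apply Real.sin_arcsin
    · linarith
    · rw [div_le_one hM0]
      exact_mod_cast j.2.le
  have hθ : ∀ i j, i ≠ j → 3 * r ≤ |Real.sin (θ i) - Real.sin (θ j)| := by
    intro i j hij
    rw [hsin, hsin, h3r, ← sub_div, abs_div, abs_of_pos hM0]
    apply div_le_div_of_nonneg_right _ hM0.le
    have h1 : ((i : ℕ) : ℤ) - ((j : ℕ) : ℤ) ≠ 0 := by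
      intro h
      apply hij
      ext
      omega
    have h2 := Int.one_le_abs h1
    exact_mod_cast h2
  refine le_trans ?_ (expected_ge (k := k) (T := T) hr hr1 θ hθ)
  have hp := prob_refEvent hr hr1
  set p := (unifDisk.prod unifDisk) (refEvent r) with hpdef
  have hra : C / T ≤ V * (r ^ 8 / 16384) := by
    have h6 : 1 / (6 * a) ≤ r := by
      rw [hrdef]
      apply one_div_le_one_div_of_le (by positivity)
      linarith
    have h8 := pow_le_pow_left₀ (by positivity) h6 8
    calc C / T = V * ((1 / (6 * a)) ^ 8 / 16384) := by
          rw [hC, ← ha8]; field_simp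
      _ ≤ _ := by gcongr
  rw [hVv, ← ENNReal.ofReal_mul hV.le] at hp
  have hp2 : ENNReal.ofReal (C / T) ≤ p := (ENNReal.ofReal_le_ofReal hra).trans hp
  have h1p : 1 - p ≤ ENNReal.ofReal (Real.exp (-(C / T))) := by
    calc 1 - p ≤ 1 - ENNReal.ofReal (C / T) := tsub_le_tsub_left hp2 _
      _ = ENNReal.ofReal (1 - C / T) := by
          rw [ENNReal.ofReal_sub _ (by positivity), ENNReal.ofReal_one]
      _ ≤ _ := ENNReal.ofReal_le_ofReal (by linarith [Real.add_one_le_exp (-(C / T))])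
  have h2p : (1 - p) ^ T ≤ ENNReal.ofReal (Real.exp (-C)) := by
    calc (1 - p) ^ T ≤ (ENNReal.ofReal (Real.exp (-(C / T)))) ^ T := by gcongr
      _ = ENNReal.ofReal (Real.exp (-C)) := by
          rw [← ENNReal.ofReal_pow (Real.exp_pos _).le, ← Real.exp_nat_mul]
          congr 2
          field_simp
  calc ENNReal.ofReal ((1 - Real.exp (-C)) * a)
      = ENNReal.ofReal a * (1 - ENNReal.ofReal (Real.exp (-C))) := by
        rw [mul_comm, ENNReal.ofReal_mul (by linarith),
          ENNReal.ofReal_sub _ (Real.exp_pos _).le, ENNReal.ofReal_one]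
    _ ≤ (M : ℝ≥0∞) * (1 - (1 - p) ^ T) := by
        gcongr
        rw [← ENNReal.ofReal_natCast]
        exact ENNReal.ofReal_le_ofReal hMa

end
end

section
/- Consider the consensus-voting group process on the closed unit disk 𝔹 (members and candidates drawn uniformly from 𝔹). Then there exists a constant C > 0 such that for every T ≥ 1, the expected group size after T rounds satisfies E[|G^T|] ≤ C·T^{1/8}. -/
open MeasureTheory Metric Set
open scoped RealInnerProductSpace ENNReal

noncomputable section

theorem bad_meas {X : Type*} [MeasurableSpace X] (ν : Measure X) [IsProbabilityMeasure ν]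
    (Good : Set (X × X)) (hG : MeasurableSet Good) (T : ℕ) (t : Fin T) :
    Measure.pi (fun _ : Fin T => ν) {c | ∀ s < t, (c t, c s) ∉ Good}
      = ∫⁻ p, (ν {c | (p, c) ∉ Good}) ^ (t : ℕ) ∂ν := by
  obtain ⟨n, rfl⟩ : ∃ n, T = n + 1 := ⟨T - 1, by have := t.2; omega⟩
  have hmp := measurePreserving_piFinSuccAbove (fun _ : Fin (n+1) => ν) t
  set S : Set (X × (Fin n → X)) := {z | ∀ s : Fin n, s.castSucc < t → (z.1, z.2 s) ∉ Good} with hS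
  have hSm : MeasurableSet S := by
    have : S = ⋂ s : Fin n, ⋂ _ : s.castSucc < t, (fun z : X × (Fin n → X) => (z.1, z.2 s)) ⁻¹' Goodᶜ := by
      ext z; simp [hS]
    rw [this]
    refine MeasurableSet.iInter fun s => MeasurableSet.iInter fun _ => ?_
    exact (by fun_prop : Measurable (fun z : X × (Fin n → X) => (z.1, z.2 s))) hG.compl
  have hpre : {c : Fin (n+1) → X | ∀ s < t, (c t, c s) ∉ Good}
      = (MeasurableEquiv.piFinSuccAbove (fun _ : Fin (n+1) => X) t) ⁻¹' S := by
    ext c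
    simp only [mem_ofPred_eq, mem_preimage, hS]
    constructor
    · intro h s hs
      have := h s.castSucc hs
      simpa [MeasurableEquiv.piFinSuccAbove, Fin.insertNthEquiv, Fin.removeNth,
        Fin.succAbove_of_castSucc_lt _ _ hs] using this
    · intro h s hs
      have hs' : s ≠ Fin.last n := (lt_of_lt_of_le hs (Fin.le_last t)).ne
      obtain ⟨s, rfl⟩ := Fin.exists_castSucc_eq.2 hs'
      have := h s hs
      simpa [MeasurableEquiv.piFinSuccAbove, Fin.insertNthEquiv, Fin.removeNth,
        Fin.succAbove_of_castSucc_lt _ _ hs] using this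
  rw [hpre, hmp.measure_preimage hSm.nullMeasurableSet, Measure.prod_apply hSm]
  refine lintegral_congr fun p => ?_
  have : Prod.mk p ⁻¹' S = Set.pi univ (fun s : Fin n => if s.castSucc < t then {c | (p, c) ∉ Good} else univ) := by
    ext c
    simp only [mem_preimage, hS, mem_ofPred_eq, Set.mem_pi, mem_univ, true_imp_iff]
    refine forall_congr' fun s => ?_
    split_ifs with h <;> simp [h]
  rw [this, Measure.pi_pi]
  have e : ∀ s : Fin n, ν (if s.castSucc < t then {c | (p, c) ∉ Good} else univ) =
     if s.castSucc < t then ν {c | (p, c) ∉ Good} else 1 := by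
    intro s; split_ifs <;> simp
  simp_rw [e]
  have e2 := Fin.prod_univ_eq_prod_range
    (fun i : ℕ => if i < (t : ℕ) then ν {c | (p, c) ∉ Good} else 1) n
  have e3 : ∀ s : Fin n, (if s.castSucc < t then ν {c | (p, c) ∉ Good} else 1)
     = if (s : ℕ) < (t : ℕ) then ν {c | (p, c) ∉ Good} else 1 := fun s => rfl
  simp_rw [e3]
  rw [e2, Finset.prod_ite]
  simp only [Finset.prod_const, one_pow, mul_one]
  have : (Finset.range n).filter (· < (t:ℕ)) = Finset.range t := by
    ext x; simp; have := t.2; omega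
  rw [this]; simp

theorem geo (q : ℝ) (h0 : 0 < q) (h1 : q ≤ 1) (T : ℕ) :
   ∑ t ∈ Finset.range T, (1-q)^t ≤ min (T:ℝ) (1/q) := by
  refine le_min ?_ ?_
  · calc _ ≤ ∑ t ∈ Finset.range T, (1:ℝ) := Finset.sum_le_sum fun t _ => pow_le_one₀ (by linarith) (by linarith)
      _ = T := by simp
  · rw [le_div_iff₀ h0]
    have := geom_sum_mul (1-q) T
    have h2 : 0 ≤ (1-q)^T := pow_nonneg (by linarith) _
    nlinarith

theorem absM {X : Type*} [MeasurableSpace X] (ν : Measure X) [IsProbabilityMeasure ν]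
    (h : X → ℝ) (hm : Measurable h) (h1 : ∀ p, h p ≤ 1)
    (Good : Set (X × X)) (hG : MeasurableSet Good) (c0 C0 : ℝ) (hc0 : 0 < c0) (hc1 : c0 ≤ 1)
    (hC0 : 0 < C0)
    (low : ∀ᵐ p ∂ν, 0 < h p → ENNReal.ofReal (c0 * h p ^ 4) ≤ ν {c | (p, c) ∈ Good})
    (up : ∀ x : ℝ, 0 < x → ν {p | h p ≤ x} ≤ ENNReal.ofReal (C0 * x ^ (7 / 2 : ℝ))) (T : ℕ) :
    ∑ t : Fin T, Measure.pi (fun _ : Fin T => ν) {c | ∀ s < t, (c t, c s) ∉ Good}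
      ≤ ENNReal.ofReal ((8 * C0 * c0 ^ (-(7/8) : ℝ)) * (T : ℝ) ^ ((1 : ℝ) / 8)) := by
  set f : X → ℝ := fun p => if 0 < h p then min (T : ℝ) (1 / (c0 * h p ^ 4)) else T with hf
  have hfm : Measurable f := by
    refine Measurable.ite (measurableSet_lt measurable_const hm) ?_ measurable_const
    fun_prop
  have hf0 : ∀ p, 0 ≤ f p := by
    intro p
    simp only [hf]
    split_ifs
    · positivity
    · positivity
  have hfT : ∀ p, f p ≤ T := by
    intro p
    simp only [hf]
    split_ifs
    · exact min_le_left _ _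
    · exact le_rfl
  have hmeas : ∀ n : ℕ, Measurable fun p => (ν {c | (p, c) ∉ Good}) ^ n := by
    intro n
    exact (measurable_measure_prodMk_left hG.compl).pow_const n
  calc ∑ t : Fin T, Measure.pi (fun _ : Fin T => ν) {c | ∀ s < t, (c t, c s) ∉ Good}
      = ∑ t : Fin T, ∫⁻ p, (ν {c | (p, c) ∉ Good}) ^ (t : ℕ) ∂ν := by
        simp_rw [bad_meas ν Good hG T]
    _ = ∫⁻ p, ∑ t : Fin T, (ν {c | (p, c) ∉ Good}) ^ (t : ℕ) ∂ν := by
        rw [lintegral_finsetSum]; intro t _; exact hmeas t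
    _ ≤ ∫⁻ p, ENNReal.ofReal (f p) ∂ν := by
        refine lintegral_mono_ae ?_
        filter_upwards [low] with p hp
        rw [Fin.sum_univ_eq_sum_range (fun t => (ν {c | (p, c) ∉ Good}) ^ t) T]
        by_cases hh : 0 < h p
        · set q := c0 * h p ^ 4
          have hq0 : 0 < q := by positivity
          have hq1 : q ≤ 1 := mul_le_one₀ hc1 (by positivity) (pow_le_one₀ hh.le (h1 p))
          have hle : ν {c | (p, c) ∉ Good} ≤ ENNReal.ofReal (1 - q) := by
            have : {c | (p, c) ∉ Good} = {c | (p, c) ∈ Good}ᶜ := rfl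
            have hmm : MeasurableSet {c | (p, c) ∈ Good} := measurable_prodMk_left hG
            rw [this, prob_compl_eq_one_sub hmm,
              ENNReal.ofReal_sub _ hq0.le, ENNReal.ofReal_one]
            exact tsub_le_tsub_left (hp hh) _
          calc _ ≤ ∑ t ∈ Finset.range T, ENNReal.ofReal (1-q) ^ t :=
                Finset.sum_le_sum fun t _ => pow_le_pow_left₀ zero_le hle t
            _ = ENNReal.ofReal (∑ t ∈ Finset.range T, (1-q)^t) := by
                rw [ENNReal.ofReal_sum_of_nonneg]
                · refine Finset.sum_congr rfl fun t _ => ?_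
                  rw [ENNReal.ofReal_pow (by linarith)]
                · intro t _; exact pow_nonneg (by linarith) _
            _ ≤ _ := by
                refine ENNReal.ofReal_le_ofReal ?_
                simp only [hf, if_pos hh]
                exact geo q hq0 hq1 T
        · simp only [hf, if_neg hh]
          calc _ ≤ ∑ t ∈ Finset.range T, (1:ℝ≥0∞) := Finset.sum_le_sum fun t _ => pow_le_one₀ zero_le prob_le_one
            _ = _ := by simp
    _ = ∫⁻ s in Ioi (0:ℝ), ν {p | s ≤ f p} :=
        lintegral_eq_lintegral_meas_le ν (Filter.Eventually.of_forall hf0) hfm.aemeasurable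
    _ ≤ ∫⁻ s in Ioi (0:ℝ), (Ioc (0:ℝ) T).indicator (fun s => ENNReal.ofReal (C0 * c0 ^ (-(7/8) : ℝ) * s ^ (-(7/8) : ℝ))) s := by
        refine setLIntegral_mono' measurableSet_Ioi ?_
        intro s hs
        have hs : 0 < s := hs
        by_cases hsT : s ≤ T
        · rw [indicator_of_mem (show s ∈ Ioc (0:ℝ) T from ⟨hs, hsT⟩)]
          have hcs : 0 < c0 * s := by positivity
          refine (measure_mono ?_).trans ((up ((c0 * s) ^ (-(1/4) : ℝ)) (by positivity)).trans ?_)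
          · intro p hp
            simp only [mem_ofPred_eq, hf] at hp ⊢
            by_cases hh : 0 < h p
            · rw [if_pos hh] at hp
              have h2 := hp.trans (min_le_right _ _)
              rw [le_div_iff₀ (by positivity)] at h2
              have h3 : h p ^ (4:ℝ) ≤ (c0 * s)⁻¹ := by
                rw [show (4:ℝ) = ((4:ℕ):ℝ) by norm_num, Real.rpow_natCast, ← one_div, le_div_iff₀ hcs]
                linarith
              have h4 := Real.rpow_le_rpow (by positivity) h3 (show (0:ℝ) ≤ 1/4 by norm_num)
              rw [← Real.rpow_mul hh.le, ← Real.rpow_neg_one, ← Real.rpow_mul hcs.le] at h4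
              norm_num at h4 ⊢
              exact h4
            · exact (not_lt.1 hh).trans (by positivity)
          · refine ENNReal.ofReal_le_ofReal (le_of_eq ?_)
            rw [← Real.rpow_mul hcs.le, Real.mul_rpow hc0.le hs.le]
            norm_num
            ring
        · have : {p | s ≤ f p} = ∅ := by
            ext p; simp; exact (hfT p).trans_lt (not_le.1 hsT)
          rw [this]; simp
    _ = ∫⁻ s in Ioc (0:ℝ) T, ENNReal.ofReal (C0 * c0 ^ (-(7/8) : ℝ) * s ^ (-(7/8) : ℝ)) := by
        rw [setLIntegral_indicator measurableSet_Ioc]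
        congr 2
        ext s; simp
    _ = ENNReal.ofReal (∫ s in Ioc (0:ℝ) T, C0 * c0 ^ (-(7/8) : ℝ) * s ^ (-(7/8) : ℝ)) := by
        rw [ofReal_integral_eq_lintegral_ofReal]
        · have := (intervalIntegral.intervalIntegrable_rpow' (a := 0) (b := T) (r := -(7/8)) (by norm_num)).const_mul (C0 * c0 ^ (-(7/8) : ℝ))
          rwa [intervalIntegrable_iff_integrableOn_Ioc_of_le (by positivity)] at this
        · filter_upwards [ae_restrict_mem measurableSet_Ioc] with s hs
          have := hs.1
          positivity
    _ = _ := by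
        rw [← intervalIntegral.integral_of_le (by positivity), intervalIntegral.integral_const_mul,
          integral_rpow (by left; norm_num)]
        norm_num
        congr 1
        ring

def cgN (p : Pt × Pt) : ℝ := √((p.2 0 - p.1 0) ^ 2 + (p.2 1 - p.1 1) ^ 2)
def cgX (p : Pt × Pt) : ℝ := (p.2 0 - p.1 0) / cgN p
def cgY (p : Pt × Pt) : ℝ := (p.2 1 - p.1 1) / cgN p
def cgR (p : Pt × Pt) : ℝ := 1 - ((p.1 0 + p.2 0) / 2 * cgX p + (p.1 1 + p.2 1) / 2 * cgY p)
def cgH (p : Pt × Pt) : ℝ := min 1 (cgR p)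
def cgA (a b : ℝ) (v : Pt) : ℝ := 1 - (a * v 0 + b * v 1)
def cgB (a b : ℝ) (v : Pt) : ℝ := -b * v 0 + a * v 1
def cgS (a b h : ℝ) : Set (Pt × Pt) :=
  {c | cgA a b c.1 ∈ Icc (h / 2) (3 * h / 4) ∧ cgA a b c.2 ∈ Icc (h / 8) (h / 4) ∧
    cgB a b c.2 ∈ Icc (-(√h / 4)) (√h / 4) ∧
    cgB a b c.1 - cgB a b c.2 ∈ Icc (-(h * √h / 16)) (h * √h / 16)}
def cgGood : Set ((Pt × Pt) × (Pt × Pt)) :=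
  {z | 0 < cgH z.1 ∧ z.2 ∈ cgS (cgX z.1) (cgY z.1) (cgH z.1)}

theorem cgN_meas : Measurable cgN := by unfold cgN; fun_prop
theorem cgX_meas : Measurable cgX := by
  unfold cgX; exact Measurable.div (by fun_prop) cgN_meas
theorem cgY_meas : Measurable cgY := by
  unfold cgY; exact Measurable.div (by fun_prop) cgN_meas
theorem cgH_meas : Measurable cgH := by
  have := cgX_meas; have := cgY_meas
  unfold cgH cgR; fun_prop

theorem cgGood_meas : MeasurableSet cgGood := by
  have hX := cgX_meas; have hY := cgY_meas; have hH := cgH_meas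
  have h1 : Measurable (fun z : (Pt × Pt) × (Pt × Pt) => cgA (cgX z.1) (cgY z.1) z.2.1) := by
    unfold cgA; fun_prop
  have h2 : Measurable (fun z : (Pt × Pt) × (Pt × Pt) => cgA (cgX z.1) (cgY z.1) z.2.2) := by
    unfold cgA; fun_prop
  have h3 : Measurable (fun z : (Pt × Pt) × (Pt × Pt) => cgB (cgX z.1) (cgY z.1) z.2.1) := by
    unfold cgB; fun_prop
  have h4 : Measurable (fun z : (Pt × Pt) × (Pt × Pt) => cgB (cgX z.1) (cgY z.1) z.2.2) := by
    unfold cgB; fun_prop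
  have h5 : Measurable (fun z : (Pt × Pt) × (Pt × Pt) => cgH z.1) := by fun_prop
  refine (measurableSet_lt measurable_const h5).inter ?_
  refine ((measurableSet_le (by fun_prop) h1).inter (measurableSet_le h1 (by fun_prop))).inter ?_
  refine ((measurableSet_le (by fun_prop) h2).inter (measurableSet_le h2 (by fun_prop))).inter ?_
  refine ((measurableSet_le (by fun_prop) h4).inter (measurableSet_le h4 (by fun_prop))).inter ?_
  exact ((measurableSet_le (by fun_prop) (h3.sub h4)).inter (measurableSet_le (h3.sub h4) (by fun_prop)))

theorem mem_disk (v : Pt) : v ∈ unitDisk ↔ v 0 ^ 2 + v 1 ^ 2 ≤ 1 := by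
  unfold unitDisk
  rw [mem_closedBall, dist_zero_right, EuclideanSpace.norm_eq, Real.sqrt_le_one]
  simp [Fin.sum_univ_two]

theorem dist_le_iff (v w w' : Pt) : dist v w ≤ dist v w' ↔
    (v 0 - w 0) ^ 2 + (v 1 - w 1) ^ 2 ≤ (v 0 - w' 0) ^ 2 + (v 1 - w' 1) ^ 2 := by
  rw [EuclideanSpace.dist_eq, EuclideanSpace.dist_eq, Real.sqrt_le_sqrt_iff (by positivity)]
  simp [Fin.sum_univ_two, Real.dist_eq, sq_abs]

theorem cgN_pos {p : Pt × Pt} (h : p.1 ≠ p.2) : 0 < cgN p := by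
  unfold cgN
  rw [Real.sqrt_pos]
  by_contra hc
  apply h
  have h0 : (p.2 0 - p.1 0) = 0 := by nlinarith [sq_nonneg (p.2 0 - p.1 0), sq_nonneg (p.2 1 - p.1 1)]
  have h1 : (p.2 1 - p.1 1) = 0 := by nlinarith [sq_nonneg (p.2 0 - p.1 0), sq_nonneg (p.2 1 - p.1 1)]
  ext i
  fin_cases i
  · simp; linarith
  · simp; linarith

theorem cgN_sq (p : Pt × Pt) : cgN p ^ 2 = (p.2 0 - p.1 0) ^ 2 + (p.2 1 - p.1 1) ^ 2 :=
  Real.sq_sqrt (by positivity)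

theorem cg_unit {p : Pt × Pt} (h : p.1 ≠ p.2) : cgX p ^ 2 + cgY p ^ 2 = 1 := by
  have := cgN_pos h
  unfold cgX cgY
  rw [div_pow, div_pow, ← add_div, ← cgN_sq, div_self (by positivity)]

/-- members of the half-plane are at depth at least the cap height -/
theorem depth_ge {p : Pt × Pt} (h : p.1 ≠ p.2) (v : Pt) (hv : dist v p.1 ≤ dist v p.2) :
    cgH p ≤ cgA (cgX p) (cgY p) v := by
  have hN := cgN_pos h
  rw [dist_le_iff] at hv
  refine (min_le_right _ _).trans ?_
  unfold cgR cgA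
  have hx : p.2 0 - p.1 0 = cgN p * cgX p := by unfold cgX; field_simp
  have hy : p.2 1 - p.1 1 = cgN p * cgY p := by unfold cgY; field_simp
  have key : 0 ≤ cgN p * (((p.1 0 + p.2 0) / 2 * cgX p + (p.1 1 + p.2 1) / 2 * cgY p)
      - (cgX p * v 0 + cgY p * v 1)) := by
    have : cgN p * (((p.1 0 + p.2 0) / 2 * cgX p + (p.1 1 + p.2 1) / 2 * cgY p)
      - (cgX p * v 0 + cgY p * v 1)) = ((p.1 0 + p.2 0) / 2 - v 0) * (cgN p * cgX p) +
      ((p.1 1 + p.2 1) / 2 - v 1) * (cgN p * cgY p) := by ring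
    rw [this, ← hx, ← hy]
    nlinarith
  have := nonneg_of_mul_nonneg_right key hN
  linarith

theorem frame_sq {a b : ℝ} (hu : a ^ 2 + b ^ 2 = 1) (v : Pt) :
    v 0 ^ 2 + v 1 ^ 2 = (1 - cgA a b v) ^ 2 + cgB a b v ^ 2 := by
  unfold cgA cgB
  linear_combination (-(v 0 ^ 2) - v 1 ^ 2) * hu

theorem frame_dist {a b : ℝ} (hu : a ^ 2 + b ^ 2 = 1) (v w : Pt) :
    (v 0 - w 0) ^ 2 + (v 1 - w 1) ^ 2 =
     (cgA a b v - cgA a b w) ^ 2 + (cgB a b v - cgB a b w) ^ 2 := by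
  unfold cgA cgB
  linear_combination (-((v 0 - w 0) ^ 2) - (v 1 - w 1) ^ 2) * hu

theorem real_ineq (α β a1 b1 a2 b2 g : ℝ) (hg : 0 < g)
    (hα : g ^ 2 ≤ α) (hβ : (1 - α) ^ 2 + β ^ 2 ≤ 1)
    (h1 : g ^ 2 / 2 ≤ a1) (h1' : a1 ≤ 3 * g ^ 2 / 4) (h2' : a2 ≤ g ^ 2 / 4)
    (h3 : |b2| ≤ g / 4) (h4 : |b1 - b2| ≤ g ^ 2 * g / 16) (hg1 : g ≤ 1) :
    (α - a1) ^ 2 + (β - b1) ^ 2 ≤ (α - a2) ^ 2 + (β - b2) ^ 2 := by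
  have e : (α - a2) ^ 2 + (β - b2) ^ 2 - ((α - a1) ^ 2 + (β - b1) ^ 2)
     = (a1 - a2) * (2 * α - a1 - a2) + (b1 - b2) * (2 * β - b1 - b2) := by ring
  have f1 : g ^ 2 / 4 * α ≤ (a1 - a2) * (2 * α - a1 - a2) :=
    mul_le_mul (by linarith) (by linarith) (by nlinarith) (by nlinarith)
  have hb1 : |2 * β - b1 - b2| ≤ 2 * |β| + 9 / 16 * g := by
    have t : 2 * β - b1 - b2 = 2 * β - (b1 - b2) - 2 * b2 := by ring
    have k1 := abs_sub (2 * β - (b1 - b2)) (2 * b2)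
    have k2 := abs_sub (2 * β) (b1 - b2)
    rw [abs_mul, abs_two] at k1 k2
    rw [t]
    have : g ^ 2 * g ≤ g := by nlinarith
    linarith
  have hβ2 : |β| ^ 2 ≤ 2 * α := by rw [sq_abs]; nlinarith
  have f3 : g * (2 * |β| + 9 / 16 * g) ≤ 4 * α := by
    nlinarith [sq_nonneg (g - |β|)]
  have f2 : |(b1 - b2) * (2 * β - b1 - b2)| ≤ g ^ 2 / 4 * α := by
    rw [abs_mul]
    calc _ ≤ (g ^ 2 * g / 16) * (2 * |β| + 9 / 16 * g) :=
          mul_le_mul h4 hb1 (abs_nonneg _) (by positivity)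
      _ = g ^ 2 / 16 * (g * (2 * |β| + 9 / 16 * g)) := by ring
      _ ≤ g ^ 2 / 16 * (4 * α) := by gcongr
      _ = _ := by ring
  have := neg_abs_le ((b1 - b2) * (2 * β - b1 - b2))
  linarith

theorem cgS_accept {a b h : ℝ} (hu : a ^ 2 + b ^ 2 = 1) (h0 : 0 < h) (h1 : h ≤ 1) (c : Pt × Pt)
    (hc : c ∈ cgS a b h) (v : Pt) (hv : v ∈ unitDisk) (hd : h ≤ cgA a b v) :
    dist v c.1 ≤ dist v c.2 := by
  obtain ⟨⟨k1, k2⟩, ⟨k3, k4⟩, k5, k6⟩ := hc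
  rw [dist_le_iff, frame_dist hu, frame_dist hu]
  rw [mem_disk, frame_sq hu] at hv
  have hs : √h ^ 2 = h := Real.sq_sqrt h0.le
  have hs0 : 0 < √h := Real.sqrt_pos.2 h0
  refine real_ineq _ _ _ _ _ _ (√h) hs0 ?_ hv ?_ ?_ ?_ ?_ ?_ ?_
  all_goals try rw [hs]
  all_goals try assumption
  · exact abs_le.2 k5
  · exact abs_le.2 k6
  · exact Real.sqrt_le_one.2 h1

theorem cgS_disk {a b h : ℝ} (hu : a ^ 2 + b ^ 2 = 1) (h0 : 0 < h) (h1 : h ≤ 1) (c : Pt × Pt)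
    (hc : c ∈ cgS a b h) : c.1 ∈ unitDisk ∧ c.2 ∈ unitDisk := by
  obtain ⟨⟨k1, k2⟩, ⟨k3, k4⟩, k5, k6⟩ := hc
  have hs : √h ^ 2 = h := Real.sq_sqrt h0.le
  have hs0 : 0 < √h := Real.sqrt_pos.2 h0
  rw [mem_disk, mem_disk, frame_sq hu, frame_sq hu]
  have hb2 : cgB a b c.2 ^ 2 ≤ (√h / 4) ^ 2 := sq_le_sq' k5.1 k5.2
  have hh : h * √h ≤ √h := by nlinarith
  have hb1 : cgB a b c.1 ^ 2 ≤ (5 * √h / 16) ^ 2 :=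
    sq_le_sq' (by linarith [k5.1, k6.1]) (by linarith [k5.2, k6.2])
  constructor <;> nlinarith

theorem grp_mono_s16 {k : ℕ} (init : Fin k → Pt) (c : ℕ → Pt × Pt) : Monotone (grp init c) := by
  refine monotone_nat_of_le_succ fun t => ?_
  change _ ⊆ step _ _
  unfold step
  split_ifs
  · exact subset_insert _ _
  · exact subset_insert _ _
  · exact le_rfl

theorem grp_disk {k : ℕ} (init : Fin k → Pt) (c : ℕ → Pt × Pt) (hi : ∀ i, init i ∈ unitDisk)
    (t : ℕ) (hc : ∀ s < t, (c s).1 ∈ unitDisk ∧ (c s).2 ∈ unitDisk) :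
    grp init c t ⊆ unitDisk := by
  induction t with
  | zero => rintro _ ⟨i, rfl⟩; exact hi i
  | succ t ih =>
    have := ih fun s hs => hc s (by omega)
    have h2 := hc t (by omega)
    change step _ _ ⊆ _
    unfold step
    split_ifs
    · exact insert_subset h2.1 this
    · exact insert_subset h2.2 this
    · exact this

theorem grp_good {k : ℕ} (init : Fin k → Pt) (c : ℕ → Pt × Pt) (hi : ∀ i, init i ∈ unitDisk)
    (t : ℕ) (hc : ∀ s < t, (c s).1 ∈ unitDisk ∧ (c s).2 ∈ unitDisk) (p : Pt × Pt)
    (hp : Accepts (grp init c t) p.1 p.2) (s : ℕ) (hs : s < t) : (p, c s) ∉ cgGood := by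
  rintro ⟨hH, hS⟩
  have hH1 : cgH p ≤ 1 := min_le_left _ _
  by_cases hne : p.1 = p.2
  · have hx : cgX p = 0 := by unfold cgX; rw [hne]; simp
    have hy : cgY p = 0 := by unfold cgY; rw [hne]; simp
    have := hS.1.2
    simp only [hx, hy, cgA] at this
    linarith
  have hu := cg_unit hne
  have hacc : Accepts (grp init c s) (c s).1 (c s).2 := by
    intro v hv
    have hvt := grp_mono_s16 init c hs.le hv
    exact cgS_accept hu hH hH1 (c s) hS v (grp_disk init c hi t hc hvt) (depth_ge hne v (hp v hvt))
  have hmem : (c s).1 ∈ grp init c (s + 1) := by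
    change _ ∈ step _ _
    unfold step
    rw [if_pos hacc]
    exact mem_insert _ _
  have h1 := depth_ge hne _ (hp _ (grp_mono_s16 init c hs hmem))
  have h2 := hS.1.2
  dsimp only at h2
  linarith

open Classical in
theorem grp_card {k : ℕ} (init : Fin k → Pt) (c : ℕ → Pt × Pt) (t : ℕ) :
    (grp init c t).ncard ≤ k + ∑ s ∈ Finset.range t,
      ((if Accepts (grp init c s) (c s).1 (c s).2 then 1 else 0) +
       (if Accepts (grp init c s) (c s).2 (c s).1 then 1 else 0)) := by
  induction t with
  | zero =>
    simp only [Finset.range_zero, Finset.sum_empty, add_zero]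
    change (Set.range init).ncard ≤ k
    rw [← image_univ]
    refine (ncard_image_le finite_univ).trans ?_
    simp [ncard_univ]
  | succ t ih =>
    rw [Finset.sum_range_succ]
    have : (grp init c (t + 1)).ncard ≤ (grp init c t).ncard +
       ((if Accepts (grp init c t) (c t).1 (c t).2 then 1 else 0) +
       (if Accepts (grp init c t) (c t).2 (c t).1 then 1 else 0)) := by
      change (step _ _).ncard ≤ _
      unfold step
      split_ifs
      · exact (ncard_insert_le _ _).trans (by omega)
      · exact (ncard_insert_le _ _).trans (by omega)
      · exact (ncard_insert_le _ _).trans (by omega)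
      · omega
    omega

theorem box_vol (a b l1 r1 l2 r2 : ℝ) (hD : 0 < a ^ 2 + b ^ 2) :
    volume {v : Pt | a * v 0 + b * v 1 ∈ Icc l1 r1 ∧ -b * v 0 + a * v 1 ∈ Icc l2 r2}
      = ENNReal.ofReal (1 / (a ^ 2 + b ^ 2)) * (ENNReal.ofReal (r1 - l1) * ENNReal.ofReal (r2 - l2)) := by
  have hm : MeasurableSet {v : Pt | a * v 0 + b * v 1 ∈ Icc l1 r1 ∧ -b * v 0 + a * v 1 ∈ Icc l2 r2} := by
    have h1 : Measurable (fun v : Pt => a * v 0 + b * v 1) := by fun_prop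
    have h2 : Measurable (fun v : Pt => -b * v 0 + a * v 1) := by fun_prop
    exact (h1 measurableSet_Icc).inter (h2 measurableSet_Icc)
  rw [← (PiLp.volume_preserving_toLp (Fin 2)).measure_preimage hm.nullMeasurableSet]
  have hdet : LinearMap.det (Matrix.toLin' !![a, b; -b, a]) = a ^ 2 + b ^ 2 := by
    rw [LinearMap.det_toLin', Matrix.det_fin_two_of]; ring
  have := Measure.addHaar_preimage_linearMap (volume : Measure (Fin 2 → ℝ))
    (f := Matrix.toLin' !![a, b; -b, a]) (by rw [hdet]; exact hD.ne') (Icc ![l1, l2] ![r1, r2])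
  rw [hdet, Real.volume_Icc_pi, abs_of_pos (by positivity)] at this
  simp only [Fin.prod_univ_two, Matrix.cons_val_zero, Matrix.cons_val_one] at this
  rw [one_div, ← this]
  congr 1
  ext v
  simp [Pi.le_def, Fin.forall_fin_two, dotProduct, Fin.sum_univ_two]
  tauto

theorem vol_disk : volume unitDisk = ENNReal.ofReal Real.pi := by
  unfold unitDisk
  rw [EuclideanSpace.volume_closedBall_fin_two]; simp

theorem disk_meas : MeasurableSet unitDisk := measurableSet_closedBall

theorem unif_apply (s : Set Pt) (hs : MeasurableSet s) :
    unifDisk s = ENNReal.ofReal (1 / Real.pi) * volume (s ∩ unitDisk) := by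
  unfold unifDisk
  rw [Measure.smul_apply, Measure.restrict_apply hs, vol_disk, smul_eq_mul, one_div,
    ENNReal.ofReal_inv_of_pos Real.pi_pos]

theorem unif_le (s : Set Pt) : unifDisk s ≤ ENNReal.ofReal (1 / Real.pi) * volume s := by
  unfold unifDisk
  rw [Measure.smul_apply, vol_disk, smul_eq_mul, one_div,
    ENNReal.ofReal_inv_of_pos Real.pi_pos]
  exact mul_le_mul_right (Measure.restrict_apply_le _ _) _

instance inst_s16 : IsProbabilityMeasure unifDisk := ⟨by
  rw [unif_apply _ MeasurableSet.univ, univ_inter, vol_disk, ← ENNReal.ofReal_mul (by positivity),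
    one_div, inv_mul_cancel₀ Real.pi_pos.ne', ENNReal.ofReal_one]⟩

theorem unif_ae : ∀ᵐ v ∂unifDisk, v ∈ unitDisk := by
  unfold unifDisk
  exact Measure.ae_smul_measure (ae_restrict_mem disk_meas) _

theorem box_unif {a b : ℝ} (hu : a ^ 2 + b ^ 2 = 1) (l1 r1 l2 r2 : ℝ) (h1 : l1 ≤ r1) (h2 : l2 ≤ r2)
    (hsub : {v : Pt | cgA a b v ∈ Icc l1 r1 ∧ cgB a b v ∈ Icc l2 r2} ⊆ unitDisk) :
    unifDisk {v : Pt | cgA a b v ∈ Icc l1 r1 ∧ cgB a b v ∈ Icc l2 r2}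
      = ENNReal.ofReal ((r1 - l1) * (r2 - l2) / Real.pi) := by
  have e : {v : Pt | cgA a b v ∈ Icc l1 r1 ∧ cgB a b v ∈ Icc l2 r2}
     = {v : Pt | a * v 0 + b * v 1 ∈ Icc (1 - r1) (1 - l1) ∧ -b * v 0 + a * v 1 ∈ Icc l2 r2} := by
    ext v
    simp only [mem_ofPred_eq, cgA, cgB, mem_Icc]
    constructor
    · rintro ⟨⟨x1, x2⟩, x3⟩; exact ⟨⟨by linarith, by linarith⟩, x3⟩
    · rintro ⟨⟨x1, x2⟩, x3⟩; exact ⟨⟨by linarith, by linarith⟩, x3⟩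
  have hm : MeasurableSet {v : Pt | cgA a b v ∈ Icc l1 r1 ∧ cgB a b v ∈ Icc l2 r2} := by
    have h1 : Measurable (fun v : Pt => cgA a b v) := by unfold cgA; fun_prop
    have h2 : Measurable (fun v : Pt => cgB a b v) := by unfold cgB; fun_prop
    exact (h1 measurableSet_Icc).inter (h2 measurableSet_Icc)
  rw [unif_apply _ hm, inter_eq_left.2 hsub, e, box_vol _ _ _ _ _ _ (by linarith), hu,
    ← ENNReal.ofReal_mul (by linarith), ← ENNReal.ofReal_mul (by positivity),
    ← ENNReal.ofReal_mul (by positivity)]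
  congr 1
  ring

theorem lower {a b h : ℝ} (hu : a ^ 2 + b ^ 2 = 1) (h0 : 0 < h) (h1 : h ≤ 1) :
    ENNReal.ofReal (1 / (512 * Real.pi ^ 2) * h ^ 4) ≤ (unifDisk.prod unifDisk) (cgS a b h) := by
  have hA : Measurable (fun v : Pt => cgA a b v) := by unfold cgA; fun_prop
  have hB : Measurable (fun v : Pt => cgB a b v) := by unfold cgB; fun_prop
  have hS : MeasurableSet (cgS a b h) := by
    refine ((hA.comp measurable_fst) measurableSet_Icc).inter ?_
    refine ((hA.comp measurable_snd) measurableSet_Icc).inter ?_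
    refine ((hB.comp measurable_snd) measurableSet_Icc).inter ?_
    exact ((hB.comp measurable_fst).sub (hB.comp measurable_snd)) measurableSet_Icc
  rw [Measure.prod_apply_symm hS]
  set R : Set Pt := {v : Pt | cgA a b v ∈ Icc (h / 8) (h / 4) ∧ cgB a b v ∈ Icc (-(√h / 4)) (√h / 4)}
    with hR
  have hs : √h ^ 2 = h := Real.sq_sqrt h0.le
  have hs0 : 0 < √h := Real.sqrt_pos.2 h0
  have hRd : R ⊆ unitDisk := by
    rintro v ⟨k1, k2⟩
    rw [mem_disk, frame_sq hu]
    have hb2 : cgB a b v ^ 2 ≤ (√h / 4) ^ 2 := sq_le_sq' k2.1 k2.2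
    nlinarith [k1.1, k1.2]
  have hRm : MeasurableSet R := (hA measurableSet_Icc).inter (hB measurableSet_Icc)
  calc _ ≤ ∫⁻ y in R, ENNReal.ofReal (h / 4 * (h * √h / 8) / Real.pi) ∂unifDisk := by
        rw [setLIntegral_const, box_unif hu _ _ _ _ (by linarith) (by linarith) hRd,
          ← ENNReal.ofReal_mul (by positivity)]
        refine ENNReal.ofReal_le_ofReal (le_of_eq ?_)
        have : h ^ 4 = h ^ 3 * √h ^ 2 := by rw [hs]; ring
        rw [this]
        field_simp
        ring
    _ ≤ ∫⁻ y in R, unifDisk ((fun x => (x, y)) ⁻¹' cgS a b h) ∂unifDisk := by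
        refine setLIntegral_mono' hRm ?_
        intro y hy
        have e : ((fun x => (x, y)) ⁻¹' cgS a b h) = {v : Pt | cgA a b v ∈ Icc (h / 2) (3 * h / 4) ∧
           cgB a b v ∈ Icc (cgB a b y - h * √h / 16) (cgB a b y + h * √h / 16)} := by
          ext v
          simp only [cgS, mem_preimage, mem_ofPred_eq, mem_Icc]
          have := hy.1; have := hy.2
          simp only [mem_Icc] at *
          constructor
          · rintro ⟨x1, _, _, x2, x3⟩; exact ⟨x1, by linarith, by linarith⟩
          · rintro ⟨x1, x2, x3⟩; exact ⟨x1, by assumption, by assumption, by linarith, by linarith⟩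
        have hp : 0 < h * √h := by positivity
        have hsub : ((fun x => (x, y)) ⁻¹' cgS a b h) ⊆ unitDisk := fun v hv => (cgS_disk hu h0 h1 _ hv).1
        rw [e] at hsub ⊢
        rw [box_unif hu _ _ _ _ (by linarith) (by linarith) hsub]
        refine ENNReal.ofReal_le_ofReal (le_of_eq ?_)
        ring
    _ ≤ _ := setLIntegral_le_lintegral _ _

theorem upper_real (w y : Pt) (x : ℝ) (hx : x < 1 / 2) (hy : y ∈ unitDisk)
    (hR : cgR (w, y) ≤ x) : 0 < x ∧ (1 - x) ^ 2 ≤ y 0 ^ 2 + y 1 ^ 2 ∧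
     |y 0 * w 0 + y 1 * w 1 - (y 0 ^ 2 + y 1 ^ 2)| ≤ 2 * x ∧
     |-(y 1) * w 0 + y 0 * w 1| ≤ 2 * x * √(2 * x) := by
  rw [mem_disk] at hy
  have hne : w ≠ y := by
    rintro rfl
    simp [cgR, cgX, cgY] at hR
    linarith
  have hN : 0 < cgN (w, y) := cgN_pos (p := (w, y)) hne
  have hu := cg_unit (p := (w, y)) hne
  have hX : y 0 - w 0 = cgN (w, y) * cgX (w, y) := by unfold cgX; field_simp
  have hY : y 1 - w 1 = cgN (w, y) * cgY (w, y) := by unfold cgY; field_simp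
  unfold cgR at hR
  dsimp only at hR
  generalize cgN (w, y) = r at *
  generalize cgX (w, y) = X at *
  generalize cgY (w, y) = Y at *
  generalize y 0 = a at *
  generalize y 1 = b at *
  obtain hw0 : w 0 = a - r * X := by linarith
  obtain hw1 : w 1 = b - r * Y := by linarith
  generalize w 0 = w0 at *
  generalize w 1 = w1 at *
  subst hw0 hw1
  have hP : ∃ P, P = a * X + b * Y := ⟨_, rfl⟩
  have hQ : ∃ Q, Q = b * X - a * Y := ⟨_, rfl⟩
  obtain ⟨P, hP⟩ := hP
  obtain ⟨Q, hQ⟩ := hQ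
  have hPQ : P ^ 2 + Q ^ 2 = a ^ 2 + b ^ 2 := by
    rw [hP, hQ]; linear_combination (a ^ 2 + b ^ 2) * hu
  have h1 : 1 - x + r / 2 ≤ P := by
    have : (a - r * X + a) / 2 * X + (b - r * Y + b) / 2 * Y = P - r / 2 := by
      rw [hP]; linear_combination (-r / 2) * hu
    linarith
  have hP1 : P ≤ 1 := by nlinarith
  have hr : r ≤ 2 * x := by linarith
  have hx0 : 0 < x := by linarith
  refine ⟨hx0, by nlinarith, ?_, ?_⟩
  · have : a * (a - r * X) + b * (b - r * Y) - (a ^ 2 + b ^ 2) = -(r * P) := by rw [hP]; ring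
    rw [this, abs_neg, abs_of_nonneg (by nlinarith)]
    nlinarith
  · have : -b * (a - r * X) + a * (b - r * Y) = r * Q := by rw [hQ]; ring
    rw [this, abs_mul, abs_of_pos hN]
    have : |Q| ≤ √(2 * x) := Real.abs_le_sqrt (by nlinarith)
    gcongr

theorem annulus (x : ℝ) (h0 : 0 < x) (h1 : x < 1 / 2) :
    unifDisk {y : Pt | (1 - x) ^ 2 ≤ y 0 ^ 2 + y 1 ^ 2} ≤ ENNReal.ofReal (2 * x) := by
  have hm : MeasurableSet {y : Pt | (1 - x) ^ 2 ≤ y 0 ^ 2 + y 1 ^ 2} :=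
    measurableSet_le measurable_const (by fun_prop)
  rw [unif_apply _ hm]
  have hsub : {y : Pt | (1 - x) ^ 2 ≤ y 0 ^ 2 + y 1 ^ 2} ∩ unitDisk ⊆ closedBall 0 1 \ ball 0 (1 - x) := by
    rintro y ⟨h, h'⟩
    refine ⟨h', ?_⟩
    rw [mem_ball, dist_zero_right, EuclideanSpace.norm_eq, not_lt]
    apply Real.le_sqrt_of_sq_le
    simpa [Fin.sum_univ_two] using h
  have hv : volume ((closedBall 0 1 : Set Pt) \ ball 0 (1 - x))
     = ENNReal.ofReal (Real.pi - (1 - x) ^ 2 * Real.pi) := by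
    rw [measure_sdiff (ball_subset_closedBall.trans (closedBall_subset_closedBall (by linarith)))
      measurableSet_ball.nullMeasurableSet measure_ball_lt_top.ne,
      EuclideanSpace.volume_closedBall_fin_two, EuclideanSpace.volume_ball_fin_two,
      ENNReal.ofReal_sub Real.pi (q := (1 - x) ^ 2 * Real.pi) (by positivity),
      ENNReal.ofReal_mul (p := (1 - x) ^ 2) (by positivity),
      ENNReal.ofReal_pow (by linarith), ENNReal.ofReal_one, one_pow, one_mul]
  refine (mul_le_mul_right (measure_mono hsub) _).trans ?_
  rw [hv, ← ENNReal.ofReal_mul (by positivity)]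
  refine ENNReal.ofReal_le_ofReal ?_
  have : 1 / Real.pi * (Real.pi - (1 - x) ^ 2 * Real.pi) = 1 - (1 - x) ^ 2 := by
    field_simp
  rw [this]
  nlinarith

theorem upper (x : ℝ) (h0 : 0 < x) :
    (unifDisk.prod unifDisk) {p | cgH p ≤ x} ≤ ENNReal.ofReal (256 * x ^ (7 / 2 : ℝ)) := by
  have hpow : x ^ (7 / 2 : ℝ) = x ^ 3 * √x := by
    rw [show (7 / 2 : ℝ) = (3 : ℕ) + 1 / 2 by norm_num, Real.rpow_add h0, Real.rpow_natCast,
      Real.sqrt_eq_rpow]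
  rw [hpow]
  rcases le_or_gt (1 / 2) x with hx | hx
  · refine prob_le_one.trans ?_
    rw [← ENNReal.ofReal_one]
    refine ENNReal.ofReal_le_ofReal ?_
    have : 1 / 2 ≤ √x := Real.le_sqrt_of_sq_le (by norm_num; linarith)
    have : (1 / 2) ^ 3 * (1 / 2) ≤ x ^ 3 * √x := by gcongr
    linarith
  have hm : MeasurableSet {p | cgH p ≤ x} := measurableSet_le cgH_meas measurable_const
  rw [Measure.prod_apply_symm hm]
  set N : Set Pt := {y : Pt | (1 - x) ^ 2 ≤ y 0 ^ 2 + y 1 ^ 2} with hN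
  have hNm : MeasurableSet N := measurableSet_le measurable_const (by fun_prop)
  have hs : √(2 * x) ≤ 2 * √x := by
    rw [Real.sqrt_mul (by norm_num)]
    gcongr
    exact Real.sqrt_le_iff.2 ⟨by norm_num, by norm_num⟩
  calc _ ≤ ∫⁻ y, N.indicator (fun _ => ENNReal.ofReal (128 * (x ^ 2 * √x))) y ∂unifDisk := by
        refine lintegral_mono_ae ?_
        filter_upwards [unif_ae] with y hy
        have key : ∀ w ∈ (fun w => (w, y)) ⁻¹' {p | cgH p ≤ x}, cgR (w, y) ≤ x := by
          intro w hw
          rcases min_le_iff.1 (show min 1 (cgR (w, y)) ≤ x from hw) with h | h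
          · linarith
          · exact h
        by_cases hyN : y ∈ N
        · rw [indicator_of_mem hyN]
          have hyN' : (1 - x) ^ 2 ≤ y 0 ^ 2 + y 1 ^ 2 := hyN
          have hD : 1 / 4 ≤ y 0 ^ 2 + y 1 ^ 2 := by nlinarith
          refine (unif_le _).trans ?_
          have hsub : (fun w => (w, y)) ⁻¹' {p | cgH p ≤ x} ⊆
             {v : Pt | y 0 * v 0 + y 1 * v 1 ∈ Icc (y 0 ^ 2 + y 1 ^ 2 - 2 * x) (y 0 ^ 2 + y 1 ^ 2 + 2 * x)
               ∧ -(y 1) * v 0 + y 0 * v 1 ∈ Icc (-(2 * x * √(2 * x))) (2 * x * √(2 * x))} := by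
            intro w hw
            obtain ⟨_, _, h3, h4⟩ := upper_real w y x hx hy (key w hw)
            rw [abs_le] at h3 h4
            exact ⟨⟨by linarith, by linarith⟩, h4⟩
          refine (mul_le_mul_right (measure_mono hsub) _).trans ?_
          rw [box_vol _ _ _ _ _ _ (by linarith), ← ENNReal.ofReal_mul (by linarith),
            ← ENNReal.ofReal_mul (by positivity), ← ENNReal.ofReal_mul (by positivity)]
          refine ENNReal.ofReal_le_ofReal ?_
          have hpi : 1 / Real.pi ≤ 1 := by
            rw [div_le_one Real.pi_pos]; linarith [Real.pi_gt_three]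
          have hDi : 1 / (y 0 ^ 2 + y 1 ^ 2) ≤ 4 := by
            rw [div_le_iff₀ (by linarith)]; linarith
          calc _ = 1 / Real.pi * (1 / (y 0 ^ 2 + y 1 ^ 2) * (4 * x * (4 * x * √(2 * x)))) := by ring
            _ ≤ 1 * (4 * (4 * x * (4 * x * (2 * √x)))) := by gcongr
            _ = _ := by ring
        · have : (fun w => (w, y)) ⁻¹' {p | cgH p ≤ x} = ∅ := by
            rw [eq_empty_iff_forall_notMem]
            intro w hw
            exact hyN (upper_real w y x hx hy (key w hw)).2.1
          rw [this]; simp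
    _ = ENNReal.ofReal (128 * (x ^ 2 * √x)) * unifDisk N := by
        rw [lintegral_indicator_const hNm]
    _ ≤ ENNReal.ofReal (128 * (x ^ 2 * √x)) * ENNReal.ofReal (2 * x) :=
        mul_le_mul_right (annulus x h0 hx) _
    _ = _ := by
        rw [← ENNReal.ofReal_mul (by positivity)]
        congr 1; ring

theorem diag_ae : ∀ᵐ p ∂(unifDisk.prod unifDisk), p.1 ≠ p.2 := by
  have hm : MeasurableSet {p : Pt × Pt | p.1 = p.2} := measurableSet_eq_fun measurable_fst measurable_snd
  rw [ae_iff]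
  have : {p : Pt × Pt | ¬ p.1 ≠ p.2} = {p | p.1 = p.2} := by ext; simp
  rw [this, Measure.prod_apply_symm hm, lintegral_eq_zero_iff (measurable_measure_prodMk_right hm)]
  refine Filter.Eventually.of_forall fun y => ?_
  have e : (fun x : Pt => (x, y)) ⁻¹' {p | p.1 = p.2} = {y} := by ext; simp
  change unifDisk ((fun x : Pt => (x, y)) ⁻¹' {p | p.1 = p.2}) = 0
  rw [e]
  refine le_antisymm ((unif_le _).trans ?_) zero_le
  simp

theorem bad_mset {X : Type*} [MeasurableSpace X] (Good : Set (X × X)) (hG : MeasurableSet Good)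
    (T : ℕ) (t : Fin T) : MeasurableSet {c : Fin T → X | ∀ s < t, (c t, c s) ∉ Good} := by
  have : {c : Fin T → X | ∀ s < t, (c t, c s) ∉ Good}
      = ⋂ s : Fin T, ⋂ _ : s < t, (fun c : Fin T → X => (c t, c s)) ⁻¹' Goodᶜ := by
    ext z; simp
  rw [this]
  refine MeasurableSet.iInter fun s => MeasurableSet.iInter fun _ => ?_
  exact (by fun_prop : Measurable (fun c : Fin T → X => (c t, c s))) hG.compl

def cgGood' : Set ((Pt × Pt) × (Pt × Pt)) := (fun z => (z.1.swap, z.2)) ⁻¹' cgGood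

theorem cgGood'_meas : MeasurableSet cgGood' :=
  (by fun_prop : Measurable (fun z : (Pt × Pt) × (Pt × Pt) => (z.1.swap, z.2))) cgGood_meas

theorem low_ae : ∀ᵐ p ∂(unifDisk.prod unifDisk), 0 < cgH p →
    ENNReal.ofReal (1 / (512 * Real.pi ^ 2) * cgH p ^ 4) ≤
      (unifDisk.prod unifDisk) {c | (p, c) ∈ cgGood} := by
  filter_upwards [diag_ae] with p hp h0
  refine (lower (cg_unit hp) h0 (min_le_left _ _)).trans (measure_mono ?_)
  intro c hc
  exact ⟨h0, hc⟩

theorem swap_mp : MeasurePreserving (Prod.swap : Pt × Pt → Pt × Pt)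
    (unifDisk.prod unifDisk) (unifDisk.prod unifDisk) := Measure.measurePreserving_swap

theorem c0_le : 1 / (512 * Real.pi ^ 2) ≤ 1 := by
  rw [div_le_one (by positivity)]
  nlinarith [Real.pi_gt_three]

def cgC : ℝ := 8 * 256 * (1 / (512 * Real.pi ^ 2)) ^ (-(7/8) : ℝ)

theorem sum1 (T : ℕ) : ∑ t : Fin T, Measure.pi (fun _ : Fin T => unifDisk.prod unifDisk)
      {c | ∀ s < t, (c t, c s) ∉ cgGood} ≤ ENNReal.ofReal (cgC * (T : ℝ) ^ ((1 : ℝ) / 8)) :=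
  absM (unifDisk.prod unifDisk) cgH cgH_meas (fun _ => min_le_left _ _) cgGood cgGood_meas
    _ 256 (by positivity) c0_le (by norm_num) low_ae upper T

theorem sum2 (T : ℕ) : ∑ t : Fin T, Measure.pi (fun _ : Fin T => unifDisk.prod unifDisk)
      {c | ∀ s < t, (c t, c s) ∉ cgGood'} ≤ ENNReal.ofReal (cgC * (T : ℝ) ^ ((1 : ℝ) / 8)) := by
  refine absM (unifDisk.prod unifDisk) (fun p => cgH p.swap) (cgH_meas.comp measurable_swap)
    (fun _ => min_le_left _ _) cgGood' cgGood'_meas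
    _ 256 (by positivity) c0_le (by norm_num) ?_ ?_ T
  · exact swap_mp.quasiMeasurePreserving.ae low_ae
  · intro x hx
    have hm : MeasurableSet {p | cgH p ≤ x} := measurableSet_le cgH_meas measurable_const
    have := swap_mp.measure_preimage hm.nullMeasurableSet
    refine le_trans (le_of_eq ?_) (upper x hx)
    rw [← this]
    rfl

theorem ext_lt {T : ℕ} (c : Fin T → Pt × Pt) (n : ℕ) (h : n < T) : extSeq c n = c ⟨n, h⟩ := by
  unfold extSeq; rw [dif_pos h]

theorem card_bound {k T : ℕ} (init : Fin k → Pt) (c : Fin T → Pt × Pt)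
    (hi : ∀ i, init i ∈ unitDisk) (hc : ∀ s, (c s).1 ∈ unitDisk ∧ (c s).2 ∈ unitDisk) :
    ((grp init (extSeq c) T).ncard : ℝ≥0∞) ≤ k + ∑ t : Fin T,
      ({c : Fin T → Pt × Pt | ∀ s < t, (c t, c s) ∉ cgGood}.indicator (fun _ => 1) c +
       {c : Fin T → Pt × Pt | ∀ s < t, (c t, c s) ∉ cgGood'}.indicator (fun _ => 1) c) := by
  classical
  have h := grp_card init (extSeq c) T
  rw [← Fin.sum_univ_eq_sum_range (fun s =>
    ((if Accepts (grp init (extSeq c) s) (extSeq c s).1 (extSeq c s).2 then 1 else 0) +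
       (if Accepts (grp init (extSeq c) s) (extSeq c s).2 (extSeq c s).1 then 1 else 0))) T] at h
  have h' : ((grp init (extSeq c) T).ncard : ℝ≥0∞) ≤ _ := Nat.cast_le.2 h
  refine h'.trans ?_
  push_cast
  gcongr with t _
  · split_ifs with hA
    · rw [indicator_of_mem]
      intro s hs
      have := grp_good init (extSeq c) hi t (fun n hn => by
        rw [ext_lt c n (hn.trans t.2)]; exact hc _) (extSeq c t) hA s hs
      rwa [ext_lt c t t.2, ext_lt c s s.2] at this
    · exact zero_le
  · split_ifs with hA
    · rw [indicator_of_mem]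
      intro s hs
      have := grp_good init (extSeq c) hi t (fun n hn => by
        rw [ext_lt c n (hn.trans t.2)]; exact hc _) (extSeq c t).swap hA s hs
      rwa [ext_lt c t t.2, ext_lt c s s.2] at this
    · exact zero_le

theorem ae_all (k T : ℕ) : ∀ᵐ ω ∂(procMeasure unifDisk k T),
    (∀ i, ω.1 i ∈ unitDisk) ∧ (∀ s, (ω.2 s).1 ∈ unitDisk ∧ (ω.2 s).2 ∈ unitDisk) := by
  unfold procMeasure
  rw [Filter.eventually_and, ae_all_iff, ae_all_iff]
  have q1 : MeasurePreserving (Prod.fst : (Fin k → Pt) × (Fin T → Pt × Pt) → _)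
    ((Measure.pi fun _ => unifDisk).prod (Measure.pi fun _ => unifDisk.prod unifDisk))
    (Measure.pi fun _ => unifDisk) := measurePreserving_fst
  have q2 : MeasurePreserving (Prod.snd : (Fin k → Pt) × (Fin T → Pt × Pt) → _)
    ((Measure.pi fun _ => unifDisk).prod (Measure.pi fun _ => unifDisk.prod unifDisk))
    (Measure.pi fun _ => unifDisk.prod unifDisk) := measurePreserving_snd
  constructor
  · intro i
    have := ((measurePreserving_eval (fun _ : Fin k => unifDisk) i).comp q1).quasiMeasurePreserving.ae unif_ae
    exact this
  · intro s
    have q3 := (measurePreserving_eval (fun _ : Fin T => unifDisk.prod unifDisk) s).comp q2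
    have r1 : MeasurePreserving (Prod.fst : Pt × Pt → Pt) (unifDisk.prod unifDisk) unifDisk := measurePreserving_fst
    have r2 : MeasurePreserving (Prod.snd : Pt × Pt → Pt) (unifDisk.prod unifDisk) unifDisk := measurePreserving_snd
    exact ((r1.comp q3).quasiMeasurePreserving.ae unif_ae).and ((r2.comp q3).quasiMeasurePreserving.ae unif_ae)

/-- For the consensus-voting group process on the closed unit disk
(with `k ≥ 1` uniform initial members and two i.i.d. uniform candidates per round), there
is a constant `C > 0` such that for every `T ≥ 1` the expected group size after `T` rounds
satisfies `E[|G^T|] ≤ C · T^{1/8}`. -/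
theorem expected_group_size_disk_upper (k : ℕ) (hk : 1 ≤ k) :
    ∃ C : ℝ, 0 < C ∧ ∀ T : ℕ, 1 ≤ T →
      ∫⁻ ω, ((grp ω.1 (extSeq ω.2) T).ncard : ℝ≥0∞) ∂(procMeasure unifDisk k T)
        ≤ ENNReal.ofReal (C * (T : ℝ) ^ ((1 : ℝ) / 8)) := by
  have hC : 0 < cgC := by unfold cgC; positivity
  refine ⟨k + 2 * cgC, by positivity, fun T hT => ?_⟩
  have q2 : MeasurePreserving (Prod.snd : (Fin k → Pt) × (Fin T → Pt × Pt) → _)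
    (procMeasure unifDisk k T)
    (Measure.pi fun _ => unifDisk.prod unifDisk) := measurePreserving_snd
  have m1 := fun t : Fin T => bad_mset cgGood cgGood_meas T t
  have m2 := fun t : Fin T => bad_mset cgGood' cgGood'_meas T t
  set F : (Fin T → Pt × Pt) → ℝ≥0∞ := fun c => k + ∑ t : Fin T,
      ({c : Fin T → Pt × Pt | ∀ s < t, (c t, c s) ∉ cgGood}.indicator (fun _ => 1) c +
       {c : Fin T → Pt × Pt | ∀ s < t, (c t, c s) ∉ cgGood'}.indicator (fun _ => 1) c) with hF
  have i1 : ∀ t : Fin T, Measurable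
      ({c : Fin T → Pt × Pt | ∀ s < t, (c t, c s) ∉ cgGood}.indicator (fun _ => (1 : ℝ≥0∞))) :=
    fun t => measurable_const.indicator (m1 t)
  have i2 : ∀ t : Fin T, Measurable
      ({c : Fin T → Pt × Pt | ∀ s < t, (c t, c s) ∉ cgGood'}.indicator (fun _ => (1 : ℝ≥0∞))) :=
    fun t => measurable_const.indicator (m2 t)
  have hFm : Measurable F :=
    measurable_const.add (Finset.measurable_fun_sum _ fun t _ => (i1 t).add (i2 t))
  have hT1 : 1 ≤ (T : ℝ) ^ ((1 : ℝ) / 8) := Real.one_le_rpow (by exact_mod_cast hT) (by norm_num)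
  calc _ ≤ ∫⁻ ω, F ω.2 ∂(procMeasure unifDisk k T) := by
        refine lintegral_mono_ae ?_
        filter_upwards [ae_all k T] with ω hω
        exact card_bound ω.1 ω.2 hω.1 hω.2
    _ = ∫⁻ c, F c ∂(Measure.pi fun _ => unifDisk.prod unifDisk) := q2.lintegral_comp hFm
    _ = k + ((∑ t : Fin T, Measure.pi (fun _ : Fin T => unifDisk.prod unifDisk)
          {c | ∀ s < t, (c t, c s) ∉ cgGood}) +
         ∑ t : Fin T, Measure.pi (fun _ : Fin T => unifDisk.prod unifDisk)
          {c | ∀ s < t, (c t, c s) ∉ cgGood'}) := by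
        have hadd : ∀ t ∈ (Finset.univ : Finset (Fin T)), Measurable fun c =>
            ({c : Fin T → Pt × Pt | ∀ s < t, (c t, c s) ∉ cgGood}.indicator (fun _ => (1 : ℝ≥0∞)) c +
            {c : Fin T → Pt × Pt | ∀ s < t, (c t, c s) ∉ cgGood'}.indicator (fun _ => 1) c) :=
          fun t _ => (i1 t).add (i2 t)
        rw [lintegral_add_left measurable_const, lintegral_const, measure_univ, mul_one,
          lintegral_finsetSum _ hadd, ← Finset.sum_add_distrib]
        congr 1
        refine Finset.sum_congr rfl fun t _ => ?_
        rw [lintegral_add_left (i1 t), lintegral_indicator_const (m1 t),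
          lintegral_indicator_const (m2 t), one_mul, one_mul]
    _ ≤ ENNReal.ofReal k + (ENNReal.ofReal (cgC * (T : ℝ) ^ ((1 : ℝ) / 8)) +
          ENNReal.ofReal (cgC * (T : ℝ) ^ ((1 : ℝ) / 8))) := by
        rw [ENNReal.ofReal_natCast]
        gcongr
        · exact sum1 T
        · exact sum2 T
    _ ≤ _ := by
        rw [← ENNReal.ofReal_add (by positivity) (by positivity),
          ← ENNReal.ofReal_add (by positivity) (by positivity)]
        refine ENNReal.ofReal_le_ofReal ?_
        have : (k : ℝ) * 1 ≤ k * (T : ℝ) ^ ((1 : ℝ) / 8) := by gcongr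
        linarith

end
end
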